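/- Let b be a slowly varying function satisfying ∫₁^∞ t^{−1} b(t) dt < ∞, and let b̂(t) = ∫_t^∞ s^{−1} b(s) ds. Then L^{(1,1,b)} = L^{1,1,b̂} with equality of the defining functionals: ‖f‖_{(1,1,b)} = ‖f‖_{1,1,b̂} for every μ-measurable f. Consequently, L^{(1,1,b)} ≠ L^{1,1,b} for every slowly varying function b. -/

import Mathlib

open MeasureTheory Set Filter ENNReal Topology

noncomputable section

/-- `f ≈ g` on `S`: two-sided equivalence with positive constants. -/
def EquivOn (f g : ℝ → ℝ) (S : Set ℝ) : Prop :=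
  ∃ c C : ℝ, 0 < c ∧ 0 < C ∧ ∀ t ∈ S, c * g t ≤ f t ∧ f t ≤ C * g t

/-- A measurable positive function on `(0,∞)` is slowly varying if for every `ε > 0`,
`t ^ ε * b t` is equivalent to a non-decreasing function and `t ^ (-ε) * b t` is
equivalent to a non-increasing function on `(0,∞)`. -/
def IsSlowlyVarying (b : ℝ → ℝ) : Prop :=
  Measurable b ∧ (∀ t ∈ Set.Ioi (0:ℝ), 0 < b t) ∧
    ∀ ε : ℝ, 0 < ε →
      (∃ bp : ℝ → ℝ, MonotoneOn bp (Set.Ioi 0) ∧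
        EquivOn (fun t => t ^ ε * b t) bp (Set.Ioi 0)) ∧
      (∃ bm : ℝ → ℝ, AntitoneOn bm (Set.Ioi 0) ∧
        EquivOn (fun t => t ^ (-ε) * b t) bm (Set.Ioi 0))

/-- The non-increasing rearrangement `f*` (with values in `ℝ≥0∞`). -/
def rearr {X : Type*} [MeasurableSpace X] (μ : Measure X) (f : X → ℝ) (t : ℝ) : ℝ≥0∞ :=
  sInf {s : ℝ≥0∞ | μ {x | s < ENNReal.ofReal |f x|} ≤ ENNReal.ofReal t}

/-- The maximal function `f**(t) = (1/t) ∫₀ᵗ f*`. -/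
def maxf {X : Type*} [MeasurableSpace X] (μ : Measure X) (f : X → ℝ) (t : ℝ) : ℝ≥0∞ :=
  (ENNReal.ofReal t)⁻¹ * ∫⁻ s in Set.Ioo (0:ℝ) t, rearr μ f s

/-- The `L^q` "norm" over a subset `S ⊆ ℝ` of an `ℝ≥0∞`-valued function. -/
def lqNorm (q : ℝ≥0∞) (S : Set ℝ) (g : ℝ → ℝ≥0∞) : ℝ≥0∞ :=
  if q = ∞ then essSup g (volume.restrict S)
  else (∫⁻ t in S, g t ^ q.toReal) ^ (1 / q.toReal)

/-- The Lorentz–Karamata functional `‖f‖_{p,q,b}`. -/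
def lkNorm {X : Type*} [MeasurableSpace X] (μ : Measure X) (p q : ℝ≥0∞) (b : ℝ → ℝ)
    (f : X → ℝ) : ℝ≥0∞ :=
  lqNorm q (Set.Ioi 0)
    (fun t => ENNReal.ofReal (t ^ (p⁻¹.toReal - q⁻¹.toReal) * b t) * rearr μ f t)

/-- The Lorentz–Karamata functional `‖f‖_{(p,q,b)}` defined via the maximal function. -/
def lkMaxNorm {X : Type*} [MeasurableSpace X] (μ : Measure X) (p q : ℝ≥0∞) (b : ℝ → ℝ)
    (f : X → ℝ) : ℝ≥0∞ :=
  lqNorm q (Set.Ioi 0)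
    (fun t => ENNReal.ofReal (t ^ (p⁻¹.toReal - q⁻¹.toReal) * b t) * maxf μ f t)

/-- The `L^q(0,∞)` norm of `t ^ (1/p - 1/q) * b t` restricted to `S`. -/
def weightNorm (p q : ℝ≥0∞) (b : ℝ → ℝ) (S : Set ℝ) : ℝ≥0∞ :=
  lqNorm q S (fun t => ENNReal.ofReal (t ^ (p⁻¹.toReal - q⁻¹.toReal) * b t))

/-- A measure is non-atomic. -/
def IsNonatomic {X : Type*} [MeasurableSpace X] (μ : Measure X) : Prop :=
  ∀ s : Set X, MeasurableSet s → 0 < μ s →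
    ∃ t, t ⊆ s ∧ MeasurableSet t ∧ 0 < μ t ∧ μ t < μ s

/-- `b̃(t) = ∫₀ᵗ s⁻¹ b(s) ds`. -/
def svTilde (b : ℝ → ℝ) (t : ℝ) : ℝ≥0∞ :=
  ∫⁻ s in Set.Ioo (0:ℝ) t, ENNReal.ofReal (s⁻¹ * b s)

/-- `b̃_∞(t) = esssup_{s ∈ (0,t)} b(s)`. -/
def svTildeSup (b : ℝ → ℝ) (t : ℝ) : ℝ≥0∞ :=
  essSup (fun s => ENNReal.ofReal (b s)) (volume.restrict (Set.Ioo (0:ℝ) t))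

/-- `b̂(t) = ∫_t^∞ s⁻¹ b(s) ds`. -/
def svHat (b : ℝ → ℝ) (t : ℝ) : ℝ≥0∞ :=
  ∫⁻ s in Set.Ioi t, ENNReal.ofReal (s⁻¹ * b s)

/-- `b̂_∞(t) = esssup_{s ∈ (t,∞)} b(s)`. -/
def svHatSup (b : ℝ → ℝ) (t : ℝ) : ℝ≥0∞ :=
  essSup (fun s => ENNReal.ofReal (b s)) (volume.restrict (Set.Ioi t))

/-- The associate functional of a functional `N`. -/
def assocNorm {X : Type*} [MeasurableSpace X] (μ : Measure X) (N : (X → ℝ) → ℝ≥0∞)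
    (f : X → ℝ) : ℝ≥0∞ :=
  ⨆ (g : X → ℝ) (_ : Measurable g) (_ : N g ≤ 1), ∫⁻ x, ENNReal.ofReal |f x * g x| ∂μ

/-- The conjugate exponent: `q' = q/(q-1)` for `q ∈ (1,∞)`, `1' = ∞`, `∞' = 1`. -/
def conjE (q : ℝ≥0∞) : ℝ≥0∞ := (1 - q⁻¹)⁻¹

/-- The interval `(0, μ(R))` inside `ℝ`, where `μ(R)` may be infinite. -/
def IooMu {X : Type*} [MeasurableSpace X] (μ : Measure X) : Set ℝ :=
  {t : ℝ | 0 < t ∧ ENNReal.ofReal t < μ Set.univ}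

/-- The embedding `L^{p₁,q₁,b₁} ↪ L^{p₂,q₂,b₂}`. -/
def lkEmbed {X : Type*} [MeasurableSpace X] (μ : Measure X) (p1 q1 : ℝ≥0∞) (b1 : ℝ → ℝ)
    (p2 q2 : ℝ≥0∞) (b2 : ℝ → ℝ) : Prop :=
  ∃ C : ℝ≥0∞, C < ∞ ∧ ∀ f : X → ℝ, Measurable f →
    lkNorm μ p2 q2 b2 f ≤ C * lkNorm μ p1 q1 b1 f

/-- A rearrangement-invariant quasi-Banach function norm. -/
structure IsRIQuasiBFN {X : Type*} [MeasurableSpace X] (μ : Measure X)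
    (N : (X → ℝ) → ℝ≥0∞) : Prop where
  abs_eq : ∀ f : X → ℝ, Measurable f → N (fun x => |f x|) = N f
  smul : ∀ (a : ℝ) (f : X → ℝ), Measurable f →
    N (fun x => a * f x) = ENNReal.ofReal |a| * N f
  eq_zero_iff : ∀ f : X → ℝ, Measurable f → (N f = 0 ↔ f =ᵐ[μ] 0)
  quasi_add : ∃ C : ℝ≥0∞, C < ∞ ∧ ∀ f g : X → ℝ, Measurable f → Measurable g →
    N (fun x => f x + g x) ≤ C * (N f + N g)
  mono : ∀ f g : X → ℝ, Measurable f → Measurable g →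
    (∀ᵐ x ∂μ, |f x| ≤ |g x|) → N f ≤ N g
  fatou : ∀ (f : ℕ → X → ℝ) (g : X → ℝ), (∀ n, Measurable (f n)) → Measurable g →
    (∀ᵐ x ∂μ, ∀ n, 0 ≤ f n x) → (∀ᵐ x ∂μ, Monotone fun n => f n x) →
    (∀ᵐ x ∂μ, Filter.Tendsto (fun n => f n x) Filter.atTop (nhds (g x))) →
    N g = ⨆ n, N (f n)
  ind_lt_top : ∀ E : Set X, MeasurableSet E → μ E < ∞ →
    N (Set.indicator E fun _ => (1:ℝ)) < ∞
  rearr_inv : ∀ f g : X → ℝ, Measurable f → Measurable g →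
    rearr μ f = rearr μ g → N f = N g

/-- A rearrangement-invariant Banach function norm. -/
structure IsRIBFN {X : Type*} [MeasurableSpace X] (μ : Measure X)
    (N : (X → ℝ) → ℝ≥0∞) : Prop where
  abs_eq : ∀ f : X → ℝ, Measurable f → N (fun x => |f x|) = N f
  smul : ∀ (a : ℝ) (f : X → ℝ), Measurable f →
    N (fun x => a * f x) = ENNReal.ofReal |a| * N f
  eq_zero_iff : ∀ f : X → ℝ, Measurable f → (N f = 0 ↔ f =ᵐ[μ] 0)
  add_le : ∀ f g : X → ℝ, Measurable f → Measurable g →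
    N (fun x => f x + g x) ≤ N f + N g
  mono : ∀ f g : X → ℝ, Measurable f → Measurable g →
    (∀ᵐ x ∂μ, |f x| ≤ |g x|) → N f ≤ N g
  fatou : ∀ (f : ℕ → X → ℝ) (g : X → ℝ), (∀ n, Measurable (f n)) → Measurable g →
    (∀ᵐ x ∂μ, ∀ n, 0 ≤ f n x) → (∀ᵐ x ∂μ, Monotone fun n => f n x) →
    (∀ᵐ x ∂μ, Filter.Tendsto (fun n => f n x) Filter.atTop (nhds (g x))) →
    N g = ⨆ n, N (f n)
  ind_lt_top : ∀ E : Set X, MeasurableSet E → μ E < ∞ →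
    N (Set.indicator E fun _ => (1:ℝ)) < ∞
  integral_le : ∀ E : Set X, MeasurableSet E → μ E < ∞ →
    ∃ C : ℝ≥0∞, C < ∞ ∧ ∀ f : X → ℝ, Measurable f →
      ∫⁻ x in E, ENNReal.ofReal |f x| ∂μ ≤ C * N f
  rearr_inv : ∀ f g : X → ℝ, Measurable f → Measurable g →
    rearr μ f = rearr μ g → N f = N g

end

lemma IsSlowlyVarying.exists_rpow_mul_le {b : ℝ → ℝ} (hb : IsSlowlyVarying b) {ε : ℝ}
    (hε : 0 < ε) :
    ∃ K : ℝ, 0 < K ∧ ∀ s t : ℝ, 0 < s → s ≤ t → s ^ ε * b s ≤ K * (t ^ ε * b t) := by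
  obtain ⟨⟨g, hg, c, C, hc, hC, h⟩, -⟩ := hb.2.2 ε hε
  refine ⟨C / c, by positivity, fun s t hs hst => ?_⟩
  have ht : 0 < t := hs.trans_le hst
  calc s ^ ε * b s ≤ C * g s := (h s hs).2
    _ ≤ C * g t := by gcongr; exact hg hs ht hst
    _ = C / c * (c * g t) := by field_simp
    _ ≤ C / c * (t ^ ε * b t) := mul_le_mul_of_nonneg_left (h t ht).1 (by positivity)

lemma IsSlowlyVarying.exists_lintegral_le {b : ℝ → ℝ} (hb : IsSlowlyVarying b) :
    ∃ K : ℝ, 0 < K ∧ ∀ t : ℝ, 0 < t →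
      ∫⁻ s in Ioo 0 t, ENNReal.ofReal (b s) ≤ ENNReal.ofReal (K * (t * b t)) := by
  obtain ⟨K, hK, h⟩ := hb.exists_rpow_mul_le (ε := 1 / 2) (by norm_num)
  refine ⟨2 * K, by positivity, fun t ht => ?_⟩
  have hbt : 0 < b t := hb.2.1 t ht
  have hle : ∀ s ∈ Ioo 0 t, b s ≤ K * (t ^ (1 / 2 : ℝ) * b t) * s ^ (-(1 / 2) : ℝ) := by
    intro s hs
    have hs0 : 0 < s := hs.1
    rw [Real.rpow_neg hs0.le, ← div_eq_mul_inv, le_div_iff₀ (by positivity), mul_comm]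
    exact h s t hs.1 hs.2.le
  have hint : IntegrableOn (fun s : ℝ => s ^ (-(1 / 2) : ℝ)) (Ioo 0 t) := by
    have := (intervalIntegral.intervalIntegrable_rpow' (a := 0) (b := t)
      (r := -(1 / 2)) (by norm_num))
    rw [intervalIntegrable_iff_integrableOn_Ioo_of_le ht.le] at this
    exact this
  calc ∫⁻ s in Ioo 0 t, ENNReal.ofReal (b s)
      ≤ ∫⁻ s in Ioo 0 t, ENNReal.ofReal
          (K * (t ^ (1 / 2 : ℝ) * b t) * s ^ (-(1 / 2) : ℝ)) :=
        setLIntegral_mono' measurableSet_Ioo fun s hs => ENNReal.ofReal_le_ofReal (hle s hs)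
    _ = ENNReal.ofReal (∫ s in Ioo 0 t, K * (t ^ (1 / 2 : ℝ) * b t) * s ^ (-(1 / 2) : ℝ)) := by
        rw [ofReal_integral_eq_lintegral_ofReal (hint.const_mul _)]
        filter_upwards [ae_restrict_mem measurableSet_Ioo] with s hs
        have hs0 : 0 < s := hs.1
        simp only [Pi.zero_apply]
        positivity
    _ = ENNReal.ofReal (2 * K * (t * b t)) := by
        congr 1
        rw [integral_const_mul, ← integral_Ioc_eq_integral_Ioo,
          ← intervalIntegral.integral_of_le ht.le, integral_rpow (Or.inl (by norm_num))]
        have h2 : t ^ (1 / 2 : ℝ) * t ^ (1 / 2 : ℝ) = t := by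
          rw [← Real.rpow_add ht]; norm_num
        have h3 : (-(1 / 2) + 1 : ℝ) = 1 / 2 := by norm_num
        rw [h3, Real.zero_rpow (by norm_num)]
        linear_combination (2 * K * b t) * h2

lemma svHat_eq_add (b : ℝ → ℝ) {x y : ℝ} (hxy : x ≤ y) :
    svHat b x = (∫⁻ s in Ioc x y, ENNReal.ofReal (s⁻¹ * b s)) + svHat b y := by
  unfold svHat
  rw [← Ioc_union_Ioi_eq_Ioi hxy, lintegral_union measurableSet_Ioi]
  exact Set.disjoint_left.2 fun s hs hs' => absurd hs.2 (not_le.2 hs')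

lemma svHat_antitone (b : ℝ → ℝ) : Antitone (svHat b) := fun _ _ h =>
  lintegral_mono_set (Ioi_subset_Ioi h)

lemma svHat_pos {b : ℝ → ℝ} (hb : IsSlowlyVarying b) {t : ℝ} (ht : 0 < t) : 0 < svHat b t := by
  have hm : Measurable fun s => ENNReal.ofReal (s⁻¹ * b s) :=
    (measurable_inv.mul hb.1).ennreal_ofReal
  rw [svHat, setLIntegral_pos_iff hm]
  have : Function.support (fun s => ENNReal.ofReal (s⁻¹ * b s)) ∩ Ioi t = Ioi t := by
    refine inter_eq_right.2 fun s hs => ?_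
    have hs0 : 0 < s := ht.trans hs
    have := hb.2.1 s hs0
    simp only [Function.mem_support, ne_eq, ENNReal.ofReal_eq_zero, not_le]
    positivity
  rw [this]
  simp

lemma svHat_lt_top {b : ℝ → ℝ} (hb : IsSlowlyVarying b)
    (hint : ∫⁻ t in Ioi (1 : ℝ), ENNReal.ofReal (t⁻¹ * b t) < ∞) {t : ℝ} (ht : 0 < t) :
    svHat b t < ∞ := by
  rcases le_total 1 t with h1 | h1
  · exact (svHat_antitone b h1).trans_lt hint
  · rw [svHat_eq_add b h1]
    refine ENNReal.add_lt_top.2 ⟨?_, hint⟩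
    obtain ⟨K, hK, h⟩ := hb.exists_rpow_mul_le one_pos
    have hle : ∀ s ∈ Ioc t 1, ENNReal.ofReal (s⁻¹ * b s)
        ≤ ENNReal.ofReal (t⁻¹ * (t⁻¹ * (K * b 1))) := by
      intro s hs
      have hs0 : 0 < s := ht.trans hs.1
      have hbs := hb.2.1 s hs0
      have hb1 := hb.2.1 1 (mem_Ioi.2 one_pos)
      have h2 := h s 1 hs0 hs.2
      simp only [Real.rpow_one, one_mul] at h2
      have h3 : s⁻¹ ≤ t⁻¹ := by gcongr; exact hs.1.le
      refine ENNReal.ofReal_le_ofReal ?_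
      gcongr
      calc b s = s⁻¹ * (s * b s) := by field_simp
        _ ≤ t⁻¹ * (K * b 1) := by gcongr
    refine (setLIntegral_mono' measurableSet_Ioc hle).trans_lt ?_
    rw [setLIntegral_const]
    exact ENNReal.mul_lt_top ENNReal.ofReal_lt_top (by simp)

/-- The quotient `b̂ / b` is unbounded near the origin. -/
lemma IsSlowlyVarying.exists_mul_lt_svHat {b : ℝ → ℝ} (hb : IsSlowlyVarying b) {C δ : ℝ}
    (hC : 0 < C) (hδ : 0 < δ) :
    ∃ t, 0 < t ∧ t < δ ∧ ENNReal.ofReal (C * b t) < svHat b t := by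
  by_contra! hcon
  set h : ℝ → ℝ := fun t => (svHat b t).toReal with hh
  have hfin : ∀ t, 0 < t → t < δ → svHat b t ≠ ∞ := fun t ht htδ =>
    ((hcon t ht htδ).trans_lt ENNReal.ofReal_lt_top).ne
  have hle : ∀ t, 0 < t → t < δ → h t ≤ C * b t := fun t ht htδ =>
    ENNReal.toReal_le_of_le_ofReal (mul_pos hC (hb.2.1 t ht)).le (hcon t ht htδ)
  set q : ℝ := 1 + 1 / (2 * C) with hq
  have hq1 : 1 < q := by rw [hq]; linarith [show 0 < 1 / (2 * C) by positivity]
  have hstep : ∀ x, 0 < x → 2 * x < δ → q * h (2 * x) ≤ h x := by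
    intro x hx hxδ
    have hfx := hfin x hx (by linarith)
    have hf2 := hfin (2 * x) (by linarith) hxδ
    have hpos : 0 ≤ h (2 * x) := ENNReal.toReal_nonneg
    have hlow : ENNReal.ofReal (1 / (2 * C) * h (2 * x))
        ≤ ∫⁻ s in Ioc x (2 * x), ENNReal.ofReal (s⁻¹ * b s) := by
      calc ENNReal.ofReal (1 / (2 * C) * h (2 * x))
          = ∫⁻ s in Ioc x (2 * x), ENNReal.ofReal ((2 * x)⁻¹ * (h (2 * x) / C)) := by
            rw [setLIntegral_const, Real.volume_Ioc, ← ENNReal.ofReal_mul (by positivity)]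
            congr 1
            field_simp
            ring
        _ ≤ _ := by
            refine setLIntegral_mono' measurableSet_Ioc fun s hs => ENNReal.ofReal_le_ofReal ?_
            have hs0 : 0 < s := hx.trans hs.1
            have hsδ : s < δ := hs.2.trans_lt hxδ
            have hbs := hb.2.1 s hs0
            have hinv : (2 * x)⁻¹ ≤ s⁻¹ := by gcongr; exact hs.2
            have hhs : h (2 * x) / C ≤ b s := by
              rw [div_le_iff₀ hC, mul_comm (b s)]
              exact (ENNReal.toReal_mono (hfin s hs0 hsδ) (svHat_antitone b hs.2)).trans
                (hle s hs0 hsδ)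
            gcongr
    have hadd := svHat_eq_add b (show x ≤ 2 * x by linarith)
    have hx2 : ENNReal.ofReal (q * h (2 * x)) ≤ svHat b x := by
      rw [hadd, ← ENNReal.ofReal_toReal hf2, hq, add_mul, one_mul, add_comm,
        ENNReal.ofReal_add (by positivity) hpos]
      gcongr
    exact (ENNReal.ofReal_le_iff_le_toReal hfx).1 hx2
  set x₀ : ℝ := δ / 2 with hx₀
  have hx₀pos : 0 < x₀ := by positivity
  have hhx₀ : 0 < h x₀ := ENNReal.toReal_pos (svHat_pos hb hx₀pos).ne'
    (hfin x₀ hx₀pos (by rw [hx₀]; linarith))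
  have hlt : ∀ k : ℕ, (1 / 2 : ℝ) ^ k * x₀ < δ := fun k => by
    have : (1 / 2 : ℝ) ^ k ≤ 1 := pow_le_one₀ (by norm_num) (by norm_num)
    have h3 : x₀ < δ := by rw [hx₀]; linarith
    nlinarith
  have hiter : ∀ k : ℕ, q ^ k * h x₀ ≤ h ((1 / 2) ^ k * x₀) := by
    intro k
    induction k with
    | zero => simp
    | succ k ih =>
      have heq : 2 * ((1 / 2 : ℝ) ^ (k + 1) * x₀) = (1 / 2) ^ k * x₀ := by ring
      have h4 := hstep ((1 / 2) ^ (k + 1) * x₀) (by positivity) (by rw [heq]; exact hlt k)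
      rw [heq] at h4
      calc q ^ (k + 1) * h x₀ = q * (q ^ k * h x₀) := by ring
        _ ≤ q * h ((1 / 2) ^ k * x₀) := by gcongr
        _ ≤ _ := h4
  set ε : ℝ := Real.logb 2 q / 2 with hε
  have hεpos : 0 < ε := by
    have := Real.logb_pos (b := 2) (by norm_num) hq1
    positivity
  obtain ⟨K, hK, hb'⟩ := hb.exists_rpow_mul_le hεpos
  have hroot : (2 : ℝ) ^ ε * (2 : ℝ) ^ ε = q := by
    rw [← Real.rpow_add (by norm_num), hε, add_halves,
      Real.rpow_logb (by norm_num) (by norm_num) (by linarith)]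
  have hroot1 : 1 < (2 : ℝ) ^ ε := Real.one_lt_rpow (by norm_num) hεpos
  have hbound : ∀ k : ℕ, ((2 : ℝ) ^ ε) ^ k ≤ C * K * b x₀ / h x₀ := by
    intro k
    have hy : 0 < (1 / 2 : ℝ) ^ k * x₀ := by positivity
    have h5 := hb' _ x₀ hy (by
      have : (1 / 2 : ℝ) ^ k ≤ 1 := pow_le_one₀ (by norm_num) (by norm_num)
      nlinarith)
    have h6 := (hiter k).trans (hle _ hy (hlt k))
    rw [Real.mul_rpow (by positivity) hx₀pos.le] at h5
    have h7 : ((1 / 2 : ℝ) ^ k) ^ ε * (((2 : ℝ) ^ ε) ^ k) = 1 := by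
      rw [← Real.rpow_natCast ((2 : ℝ) ^ ε) k, ← Real.rpow_mul (by norm_num), mul_comm ε,
        Real.rpow_mul (by norm_num), Real.rpow_natCast, ← Real.mul_rpow (by positivity)
        (by positivity), ← mul_pow]
      norm_num
    have hp : 0 < x₀ ^ ε := by positivity
    have h8 : ((1 / 2 : ℝ) ^ k) ^ ε * b ((1 / 2) ^ k * x₀) ≤ K * b x₀ := by
      refine le_of_mul_le_mul_left ?_ hp
      linarith
    rw [le_div_iff₀ hhx₀]
    set r := (2 : ℝ) ^ ε
    have hr : 0 < r ^ k := by positivity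
    set u := ((1 / 2 : ℝ) ^ k) ^ ε
    have hu : 0 < u := by positivity
    calc r ^ k * h x₀ = u * (q ^ k * h x₀) := by
          rw [← hroot, mul_pow]; linear_combination (-(r ^ k * h x₀)) * h7
      _ ≤ u * (C * b ((1 / 2) ^ k * x₀)) := by gcongr
      _ = C * (u * b ((1 / 2) ^ k * x₀)) := by ring
      _ ≤ C * (K * b x₀) := by gcongr
      _ = _ := by ring
  obtain ⟨n, hn⟩ := pow_unbounded_of_one_lt (C * K * b x₀ / h x₀) hroot1
  exact absurd (hbound n) (not_le.2 hn)

lemma rearr_antitone {X : Type*} [MeasurableSpace X] (μ : Measure X) (f : X → ℝ) :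
    Antitone (rearr μ f) := fun _ _ h =>
  sInf_le_sInf fun _ hs => le_trans hs (ENNReal.ofReal_le_ofReal h)

lemma lkNorm_one_one {X : Type*} [MeasurableSpace X] (μ : Measure X) (b : ℝ → ℝ) (f : X → ℝ) :
    lkNorm μ 1 1 b f = ∫⁻ t in Ioi 0, ENNReal.ofReal (b t) * rearr μ f t := by
  simp [lkNorm, lqNorm]

lemma lkMaxNorm_one_one {X : Type*} [MeasurableSpace X] (μ : Measure X) {b : ℝ → ℝ}
    (hb : Measurable b) (f : X → ℝ) :
    lkMaxNorm μ 1 1 b f = ∫⁻ t in Ioi 0, svHat b t * rearr μ f t := by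
  have hr : Measurable (rearr μ f) := (rearr_antitone μ f).measurable
  have hw : Measurable fun s => ENNReal.ofReal (s⁻¹ * b s) :=
    (measurable_inv.mul hb).ennreal_ofReal
  have hF : Measurable (Function.uncurry fun t s : ℝ =>
      (Iio t).indicator (fun s => ENNReal.ofReal (t⁻¹ * b t) * rearr μ f s) s) := by
    have : (Function.uncurry fun t s : ℝ =>
        (Iio t).indicator (fun s => ENNReal.ofReal (t⁻¹ * b t) * rearr μ f s) s)
        = {p : ℝ × ℝ | p.2 < p.1}.indicator
          (fun p => ENNReal.ofReal (p.1⁻¹ * b p.1) * rearr μ f p.2) := by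
      ext ⟨t, s⟩
      simp [indicator]
    rw [this]
    exact ((hw.comp measurable_fst).mul (hr.comp measurable_snd)).indicator
      (measurableSet_lt measurable_snd measurable_fst)
  calc lkMaxNorm μ 1 1 b f
      = ∫⁻ t in Ioi 0, ENNReal.ofReal (b t) * maxf μ f t := by simp [lkMaxNorm, lqNorm]
    _ = ∫⁻ t in Ioi 0, ∫⁻ s in Ioi 0,
          (Iio t).indicator (fun s => ENNReal.ofReal (t⁻¹ * b t) * rearr μ f s) s := by
        refine setLIntegral_congr_fun measurableSet_Ioi fun t ht => ?_
        have ht0 : 0 < t := ht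
        simp only [maxf]
        rw [← mul_assoc, lintegral_indicator measurableSet_Iio,
          Measure.restrict_restrict measurableSet_Iio, Iio_inter_Ioi, lintegral_const_mul _ hr,
          ENNReal.ofReal_mul (inv_nonneg.2 ht0.le), ENNReal.ofReal_inv_of_pos ht0,
          mul_comm (ENNReal.ofReal (b t))]
    _ = ∫⁻ s in Ioi 0, ∫⁻ t in Ioi 0,
          (Iio t).indicator (fun s => ENNReal.ofReal (t⁻¹ * b t) * rearr μ f s) s :=
        lintegral_lintegral_swap hF.aemeasurable
    _ = _ := by
        refine setLIntegral_congr_fun measurableSet_Ioi fun s hs => ?_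
        have hs0 : 0 < s := hs
        have : ∀ t : ℝ, (Iio t).indicator
            (fun s => ENNReal.ofReal (t⁻¹ * b t) * rearr μ f s) s
            = (Ioi s).indicator (fun t => ENNReal.ofReal (t⁻¹ * b t) * rearr μ f s) t := by
          intro t
          simp [indicator]
        simp only [this]
        rw [lintegral_indicator measurableSet_Ioi, Measure.restrict_restrict measurableSet_Ioi,
          Ioi_inter_Ioi, max_eq_left hs0.le, lintegral_mul_const _ hw]
        rfl

section Nonatomic

variable {X : Type*} [MeasurableSpace X] {μ : Measure X}

lemma IsNonatomic.exists_subset_le_half (hna : IsNonatomic μ) {A : Set X}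
    (hA : MeasurableSet A) (hA0 : 0 < μ A) :
    ∃ B ⊆ A, MeasurableSet B ∧ 0 < μ B ∧ μ B ≤ μ A / 2 := by
  obtain ⟨t, htA, ht, ht0, htlt⟩ := hna A hA hA0
  by_cases h : μ t ≤ μ A / 2
  · exact ⟨t, htA, ht, ht0, h⟩
  have hadd : μ t + μ (A \ t) = μ A := by
    rw [← measure_union disjoint_sdiff_right (hA.diff ht), union_sdiff_cancel htA]
  refine ⟨A \ t, sdiff_subset, hA.diff ht, ?_, ?_⟩
  · refine pos_iff_ne_zero.2 fun h0 => ?_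
    rw [h0, add_zero] at hadd
    exact htlt.ne hadd
  · by_contra h'
    have := ENNReal.add_lt_add (not_le.1 h) (not_le.1 h')
    rw [ENNReal.add_halves, hadd] at this
    exact lt_irrefl _ this

lemma IsNonatomic.exists_subset_lt (hna : IsNonatomic μ) {A : Set X}
    (hA : MeasurableSet A) (hA0 : 0 < μ A) (hAf : μ A < ∞) {ε : ℝ≥0∞} (hε : 0 < ε) :
    ∃ B ⊆ A, MeasurableSet B ∧ 0 < μ B ∧ μ B < ε := by
  have hn : ∀ n : ℕ, ∃ B ⊆ A, MeasurableSet B ∧ 0 < μ B ∧ μ B ≤ μ A * 2⁻¹ ^ n := by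
    intro n
    induction n with
    | zero => exact ⟨A, subset_rfl, hA, hA0, by simp⟩
    | succ n ih =>
      obtain ⟨B, hBA, hB, hB0, hle⟩ := ih
      obtain ⟨D, hDB, hD, hD0, hDle⟩ := hna.exists_subset_le_half hB hB0
      refine ⟨D, hDB.trans hBA, hD, hD0, hDle.trans ?_⟩
      rw [pow_succ, ← mul_assoc, ENNReal.div_eq_inv_mul, mul_comm]
      gcongr
  have hlim : Tendsto (fun n : ℕ => μ A * (2⁻¹ : ℝ≥0∞) ^ n) atTop (𝓝 0) := by
    simpa using ENNReal.Tendsto.const_mul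
      (ENNReal.tendsto_pow_atTop_nhds_zero_of_lt_one (r := 2⁻¹) (by simp)) (Or.inr hAf.ne)
  obtain ⟨n, hlt⟩ := (hlim.eventually_lt_const hε).exists
  obtain ⟨B, hBA, hB, hB0, hle⟩ := hn n
  exact ⟨B, hBA, hB, hB0, hle.trans_lt hlt⟩

/-- Sierpiński's theorem: a non-atomic measure attains every value below the measure of a
set of finite measure on a subset of it. -/
lemma IsNonatomic.exists_subset_measure_eq (hna : IsNonatomic μ) {E : Set X}
    (hE : MeasurableSet E) (hEf : μ E < ∞) {t : ℝ≥0∞} (ht : t ≤ μ E) :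
    ∃ A ⊆ E, MeasurableSet A ∧ μ A = t := by
  have htf : t ≠ ∞ := (ht.trans_lt hEf).ne
  let P := {A : Set X // A ⊆ E ∧ MeasurableSet A ∧ μ A ≤ t}
  have hstep : ∀ A : P, ∃ A' : P, A.1 ⊆ A'.1 ∧ ∀ B ⊆ E \ A.1, MeasurableSet B →
      μ A.1 + μ B ≤ t → μ B + 2 * μ A.1 ≤ 2 * μ A'.1 := by
    rintro ⟨A, hAE, hA, hAt⟩
    set Q := {B : Set X // B ⊆ E \ A ∧ MeasurableSet B ∧ μ A + μ B ≤ t}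
    set S : ℝ≥0∞ := ⨆ B : Q, μ B.1 with hS
    have hSle : ∀ B ⊆ E \ A, MeasurableSet B → μ A + μ B ≤ t → μ B ≤ S := fun B h1 h2 h3 =>
      le_iSup (fun B : Q => μ B.1) ⟨B, h1, h2, h3⟩
    by_cases hS0 : S = 0
    · refine ⟨⟨A, hAE, hA, hAt⟩, subset_rfl, fun B h1 h2 h3 => ?_⟩
      have := hSle B h1 h2 h3
      rw [hS0] at this
      simp [le_antisymm this bot_le]
    · have hSt : S ≤ t := iSup_le fun B => le_add_self.trans B.2.2.2
      obtain ⟨⟨D, hDE, hD, hDt⟩, hlt⟩ := lt_iSup_iff.1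
        (ENNReal.half_lt_self hS0 (hSt.trans_lt htf.lt_top).ne)
      have hun : μ (A ∪ D) = μ A + μ D :=
        measure_union (disjoint_sdiff_right.mono_right hDE) hD
      refine ⟨⟨A ∪ D, union_subset hAE (hDE.trans sdiff_subset), hA.union hD, hun ▸ hDt⟩,
        subset_union_left, fun B h1 h2 h3 => ?_⟩
      have h4 : S ≤ 2 * μ D := by
        rw [mul_comm, ← ENNReal.div_le_iff_le_mul (by simp) (by simp)]
        exact hlt.le
      simp only [hun]
      rw [mul_add, add_comm]
      gcongr
      exact (hSle B h1 h2 h3).trans h4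
  choose next hsub hnext using hstep
  let A : ℕ → P := fun n => Nat.rec ⟨∅, by simp⟩ (fun _ => next) n
  have hA : ∀ n, A (n + 1) = next (A n) := fun n => rfl
  have hmono : Monotone fun n => (A n).1 := monotone_nat_of_le_succ fun n => by
    rw [hA]; exact hsub _
  have hUE : (⋃ n, (A n).1) ⊆ E := iUnion_subset fun n => (A n).2.1
  have hU : MeasurableSet (⋃ n, (A n).1) := MeasurableSet.iUnion fun n => (A n).2.2.1
  have hsup : μ (⋃ n, (A n).1) = ⨆ n, μ (A n).1 := hmono.measure_iUnion
  have hUt : μ (⋃ n, (A n).1) ≤ t := hsup ▸ iSup_le fun n => (A n).2.2.2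
  refine ⟨_, hUE, hU, le_antisymm hUt (not_lt.1 fun hlt => ?_)⟩
  have hUf : μ (⋃ n, (A n).1) ≠ ∞ := (hlt.trans_le le_top).ne
  have hpos : 0 < μ (E \ ⋃ n, (A n).1) := by
    rw [measure_sdiff hUE hU.nullMeasurableSet hUf]
    exact tsub_pos_of_lt (hlt.trans_le ht)
  obtain ⟨B, hBE, hB, hB0, hBlt⟩ := hna.exists_subset_lt (hE.diff hU) hpos
    ((measure_mono sdiff_subset).trans_lt hEf) (tsub_pos_of_lt hlt)
  have hBt : μ (⋃ n, (A n).1) + μ B ≤ t := by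
    rw [add_comm]
    exact (lt_tsub_iff_right.1 hBlt).le
  have key : ∀ n, μ B + 2 * μ (A n).1 ≤ 2 * μ (⋃ n, (A n).1) := fun n => by
    have h1 := hnext (A n) B (hBE.trans (sdiff_subset_sdiff_right (subset_iUnion (fun n => (A n).1) n))) hB
      (le_trans (by gcongr; exact subset_iUnion (fun n => (A n).1) n) hBt)
    refine h1.trans ?_
    rw [← hA]
    gcongr
    exact subset_iUnion (fun n => (A n).1) (n + 1)
  have hfinal : μ B + 2 * μ (⋃ n, (A n).1) ≤ 2 * μ (⋃ n, (A n).1) := by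
    conv_lhs => rw [hsup, ENNReal.mul_iSup, ENNReal.add_iSup]
    exact iSup_le key
  have h2 : 2 * μ (⋃ n, (A n).1) ≠ ∞ := ENNReal.mul_ne_top (by simp) hUf
  have h3 : μ B ≤ 0 := by
    rw [← ENNReal.add_le_add_iff_right h2, zero_add]
    exact hfinal
  exact hB0.ne' (le_antisymm h3 bot_le)

lemma IsNonatomic.exists_antitone_seq [SigmaFinite μ] (hna : IsNonatomic μ)
    (hμ : μ univ = ∞) {p : ℕ → ℝ → Prop} (hp : ∀ k δ, 0 < δ → ∃ t, 0 < t ∧ t < δ ∧ p k t) :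
    ∃ (F : ℕ → Set X) (t : ℕ → ℝ), (∀ k, MeasurableSet (F k)) ∧ Antitone F ∧
      (⋂ k, F k) = ∅ ∧ (∀ k, μ (F k) = ENNReal.ofReal (t k)) ∧ (∀ k, 0 < t k) ∧
      ∀ k, p k (t k) := by
  let P := {A : Set X // MeasurableSet A ∧ 0 < μ A ∧ μ A < ∞}
  have hstep : ∀ (k : ℕ) (A : P), ∃ A' : P, A'.1 ⊆ A.1 ∧ μ A'.1 ≤ μ A.1 * 2⁻¹ ∧
      p k (μ A'.1).toReal := by
    rintro k ⟨A, hA, hA0, hAf⟩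
    obtain ⟨t, ht, htA, hpt⟩ := hp k ((μ A).toReal / 2)
      (half_pos (ENNReal.toReal_pos hA0.ne' hAf.ne))
    have htle : ENNReal.ofReal t ≤ μ A * 2⁻¹ := by
      refine (ENNReal.ofReal_le_ofReal htA.le).trans_eq ?_
      rw [div_eq_mul_inv, ENNReal.ofReal_mul ENNReal.toReal_nonneg,
        ENNReal.ofReal_toReal hAf.ne, ENNReal.ofReal_inv_of_pos two_pos]
      simp
    have hle : μ A * 2⁻¹ ≤ μ A := mul_le_of_le_one_right' (by simp)
    obtain ⟨B, hBA, hB, hBt⟩ := hna.exists_subset_measure_eq hA hAf (htle.trans hle)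
    refine ⟨⟨B, hB, ?_, ?_⟩, hBA, ?_, ?_⟩
    · rw [hBt]; simpa using ht
    · rw [hBt]; exact ENNReal.ofReal_lt_top
    · simp only [hBt]; exact htle
    · simp only [hBt, ENNReal.toReal_ofReal ht.le]; exact hpt
  choose next hsub hhalf hnext using hstep
  obtain ⟨E₀, hE₀, -, hE₀0, hE₀f⟩ := Measure.exists_subset_measure_lt_top (μ := μ)
    MeasurableSet.univ (show 0 < μ univ by simp [hμ])
  let A : ℕ → P := fun n => Nat.rec ⟨E₀, hE₀, hE₀0, hE₀f⟩ next n
  have hA : ∀ n, A (n + 1) = next n (A n) := fun n => rfl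
  have hanti : Antitone fun n => (A n).1 := antitone_nat_of_succ_le fun n => by
    rw [hA]; exact hsub _ _
  have hsmall : ∀ n, μ (A n).1 ≤ μ E₀ * 2⁻¹ ^ n := by
    intro n
    induction n with
    | zero => simp [A]
    | succ n ih =>
      rw [hA, pow_succ, ← mul_assoc]
      exact (hhalf n (A n)).trans (by gcongr)
  have hlim : Tendsto (fun n : ℕ => μ E₀ * (2⁻¹ : ℝ≥0∞) ^ n) atTop (𝓝 0) := by
    simpa using ENNReal.Tendsto.const_mul
      (ENNReal.tendsto_pow_atTop_nhds_zero_of_lt_one (r := 2⁻¹) (by simp)) (Or.inr hE₀f.ne)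
  have hnull : μ (⋂ n, (A n).1) = 0 := le_antisymm
    (ge_of_tendsto' hlim fun n => (measure_mono (iInter_subset _ n)).trans (hsmall n)) bot_le
  have hI : MeasurableSet (⋂ n, (A n).1) := MeasurableSet.iInter fun n => (A n).2.1
  refine ⟨fun n => (A (n + 1)).1 \ ⋂ n, (A n).1, fun n => (μ (A (n + 1)).1).toReal,
    fun n => (A (n + 1)).2.1.diff hI, fun m n h => sdiff_subset_sdiff_left (hanti (Nat.succ_le_succ h)), ?_,
    fun n => ?_, fun n => ENNReal.toReal_pos (A (n + 1)).2.2.1.ne' (A (n + 1)).2.2.2.ne,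
    fun n => hnext n (A n)⟩
  · refine eq_empty_of_forall_notMem fun x hx => ?_
    rw [mem_iInter] at hx
    exact (hx 0).2 (mem_iInter.2 fun n => hanti (Nat.le_succ n) (hx n).1)
  · rw [measure_sdiff_null hnull, ENNReal.ofReal_toReal (A (n + 1)).2.2.2.ne]

/-- Two-sided control of the rearrangement of `∑ k, a k • 𝟙_{F k}` for decreasing sets `F k`
with empty intersection. -/
lemma exists_rearr_of_antitone_seq {F : ℕ → Set X} {t a : ℕ → ℝ}
    (hF : ∀ k, MeasurableSet (F k)) (hanti : Antitone F) (hempty : (⋂ k, F k) = ∅)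
    (hμF : ∀ k, μ (F k) = ENNReal.ofReal (t k)) (ht : ∀ k, 0 < t k) :
    ∃ f : X → ℝ, Measurable f ∧
      (∀ s, 0 < s → rearr μ f s ≤ ∑' k, (Iio (t k)).indicator (fun _ => ENNReal.ofReal (a k)) s) ∧
      ∀ k, ∀ s < t k, ENNReal.ofReal (a k) ≤ rearr μ f s := by
  set g : X → ℝ≥0∞ := fun x => ∑' k, (F k).indicator (fun _ => ENNReal.ofReal (a k)) x with hg
  have hgm : Measurable g := Measurable.tsum fun k => measurable_const.indicator (hF k)
  have hgfin : ∀ x, g x ≠ ∞ := by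
    intro x
    have hx : x ∉ ⋂ k, F k := by simp [hempty]
    obtain ⟨n, hn⟩ := not_forall.1 (fun h => hx (mem_iInter.2 h))
    have : g x = ∑ k ∈ Finset.range n, (F k).indicator (fun _ => ENNReal.ofReal (a k)) x := by
      refine tsum_eq_sum fun k hk => indicator_of_notMem (fun hxk => hn ?_) _
      exact hanti (by simpa using hk) hxk
    rw [this]
    refine (ENNReal.sum_lt_top.2 fun k _ => ?_).ne
    exact (indicator_le_self _ _ x).trans_lt ENNReal.ofReal_lt_top
  have hfg : ∀ x, ENNReal.ofReal |(g x).toReal| = g x := fun x => by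
    rw [abs_of_nonneg ENNReal.toReal_nonneg, ENNReal.ofReal_toReal (hgfin x)]
  refine ⟨fun x => (g x).toReal, hgm.ennreal_toReal, fun s hs => sInf_le ?_,
    fun k s hs => le_sInf fun r hr => not_lt.1 fun hlt => ?_⟩
  · have hlim : Tendsto (fun k => μ (F k)) atTop (𝓝 0) := by
      have := tendsto_measure_iInter_atTop (μ := μ) (fun k => (hF k).nullMeasurableSet) hanti
        ⟨0, by simp [hμF]⟩
      simpa [hempty, Function.comp_def] using this
    have hex : ∃ n, t n ≤ s := by
      obtain ⟨n, hn⟩ := (hlim.eventually_lt_const (ENNReal.ofReal_pos.2 hs)).exists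
      rw [hμF, ENNReal.ofReal_lt_ofReal_iff hs] at hn
      exact ⟨n, hn.le⟩
    classical
    simp only [mem_ofPred_eq, hfg]
    have hsub : {x | ∑' k, (Iio (t k)).indicator (fun _ => ENNReal.ofReal (a k)) s < g x}
        ⊆ F (Nat.find hex) := by
      intro x hx
      by_contra hxF
      refine absurd hx (not_lt.2 (ENNReal.tsum_le_tsum fun k => ?_))
      by_cases hk : s < t k
      · rw [indicator_of_mem (mem_Iio.2 hk)]
        exact indicator_le_self _ _ x
      · rw [indicator_of_notMem (s := F k)]
        · exact bot_le
        · exact fun hxk => hxF (hanti (Nat.find_min' hex (not_lt.1 hk)) hxk)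
    refine (measure_mono hsub).trans ?_
    rw [hμF]
    exact ENNReal.ofReal_le_ofReal (Nat.find_spec hex)
  · simp only [mem_ofPred_eq, hfg] at hr
    have hsub : F k ⊆ {x | r < g x} := fun x hx => by
      refine hlt.trans_le ?_
      calc ENNReal.ofReal (a k) = (F k).indicator (fun _ => ENNReal.ofReal (a k)) x := by
            rw [indicator_of_mem hx]
        _ ≤ g x := ENNReal.le_tsum k
    have h1 := (measure_mono hsub).trans hr
    rw [hμF] at h1
    exact absurd h1 (not_le.2 ((ENNReal.ofReal_lt_ofReal_iff (ht k)).2 hs))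

/-- For every slowly varying `b` some function lies in `L^{1,1,b}` but not in `L^{(1,1,b)}`. -/
lemma IsSlowlyVarying.exists_lkNorm_lt_top_lkMaxNorm_eq_top [SigmaFinite μ]
    (hna : IsNonatomic μ) (hμ : μ univ = ∞) {b : ℝ → ℝ} (hb : IsSlowlyVarying b) :
    ∃ f : X → ℝ, Measurable f ∧ lkNorm μ 1 1 b f < ∞ ∧ lkMaxNorm μ 1 1 b f = ∞ := by
  obtain ⟨F, t, hF, hanti, hempty, hμF, ht, hlt⟩ := hna.exists_antitone_seq hμ
    (p := fun k t => ENNReal.ofReal (4 ^ k * b t) < svHat b t)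
    fun k δ hδ => hb.exists_mul_lt_svHat (by positivity) hδ
  have hbt : ∀ k, 0 < b (t k) := fun k => hb.2.1 _ (ht k)
  obtain ⟨f, hf, hup, hlow⟩ := exists_rearr_of_antitone_seq
    (a := fun k => 1 / (2 ^ k * (t k * b (t k)))) hF hanti hempty hμF ht
  have hbm : Measurable fun s => ENNReal.ofReal (b s) := hb.1.ennreal_ofReal
  refine ⟨f, hf, ?_, ?_⟩
  · obtain ⟨K, hK, hKle⟩ := hb.exists_lintegral_le
    rw [lkNorm_one_one]
    calc ∫⁻ s in Ioi 0, ENNReal.ofReal (b s) * rearr μ f s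
        ≤ ∫⁻ s in Ioi 0, ∑' k, (Iio (t k)).indicator
            (fun s => ENNReal.ofReal (1 / (2 ^ k * (t k * b (t k)))) * ENNReal.ofReal (b s)) s := by
          refine setLIntegral_mono' measurableSet_Ioi fun s hs => ?_
          refine (mul_le_mul_right (hup s hs) _).trans_eq ?_
          rw [← ENNReal.tsum_mul_left]
          congr with k
          by_cases hk : s < t k <;> simp [indicator, hk, mul_comm]
      _ = ∑' k, ENNReal.ofReal (1 / (2 ^ k * (t k * b (t k)))) *
            ∫⁻ s in Ioo 0 (t k), ENNReal.ofReal (b s) := by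
          rw [lintegral_tsum fun k =>
            ((hbm.const_mul _).indicator measurableSet_Iio).aemeasurable]
          congr with k
          rw [lintegral_indicator measurableSet_Iio, Measure.restrict_restrict measurableSet_Iio,
            Iio_inter_Ioi, lintegral_const_mul _ hbm]
      _ ≤ ∑' k : ℕ, ENNReal.ofReal (K * (1 / 2) ^ k) := by
          refine ENNReal.tsum_le_tsum fun k => ?_
          refine (mul_le_mul_right (hKle (t k) (ht k)) _).trans_eq ?_
          have h1 := ht k
          have h2 := hbt k
          rw [← ENNReal.ofReal_mul (by positivity)]
          congr 1
          rw [div_pow, one_pow]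
          field_simp
      _ < ∞ := ((summable_geometric_two.mul_left K).tsum_ofReal_lt_top)
  · have hge : ∀ k : ℕ, ENNReal.ofReal (2 ^ k) ≤ lkMaxNorm μ 1 1 b f := by
      intro k
      have h1 := ht k
      have h2 := hbt k
      rw [lkMaxNorm_one_one μ hb.1]
      calc ENNReal.ofReal (2 ^ k)
          = ∫⁻ s in Ioo 0 (t k), ENNReal.ofReal (4 ^ k * b (t k)) *
              ENNReal.ofReal (1 / (2 ^ k * (t k * b (t k)))) := by
            rw [setLIntegral_const, Real.volume_Ioo, ← ENNReal.ofReal_mul (by positivity),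
              ← ENNReal.ofReal_mul (by positivity)]
            congr 1
            rw [show (4 : ℝ) = 2 * 2 by norm_num, mul_pow]
            field_simp
            ring
        _ ≤ ∫⁻ s in Ioo 0 (t k), svHat b s * rearr μ f s := by
            refine setLIntegral_mono' measurableSet_Ioo fun s hs => ?_
            exact mul_le_mul' ((hlt k).le.trans (svHat_antitone b hs.2.le)) (hlow k s hs.2)
        _ ≤ _ := lintegral_mono_set Ioo_subset_Ioi_self
    have hlim : Tendsto (fun k : ℕ => ENNReal.ofReal (2 ^ k)) atTop (𝓝 ∞) :=
      ENNReal.tendsto_ofReal_atTop.comp (tendsto_pow_atTop_atTop_of_one_lt one_lt_two)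
    exact top_le_iff.1 (le_of_tendsto' hlim hge)

end Nonatomic

/-- Proposition PEbbH: `L^{(1,1,b)} = L^{1,1,b̂}` with equality of the
defining functionals, and consequently `L^{(1,1,b)} ≠ L^{1,1,b}` for every slowly
varying `b`. -/
theorem lkMaxNorm_one_one_eq_hat {X : Type*} [MeasurableSpace X] (μ : Measure X)
    [SigmaFinite μ] (hna : IsNonatomic μ) (hμ : μ Set.univ = ∞)
    (b : ℝ → ℝ) (hb : IsSlowlyVarying b)
    (hint : ∫⁻ t in Set.Ioi (1:ℝ), ENNReal.ofReal (t⁻¹ * b t) < ∞) :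
    (∀ f : X → ℝ, Measurable f →
      lkMaxNorm μ 1 1 b f = lkNorm μ 1 1 (fun t => (svHat b t).toReal) f) ∧
    (∀ b' : ℝ → ℝ, IsSlowlyVarying b' →
      {f : X → ℝ | Measurable f ∧ lkMaxNorm μ 1 1 b' f < ∞} ≠
        {f : X → ℝ | Measurable f ∧ lkNorm μ 1 1 b' f < ∞}) := by
  refine ⟨fun f _ => ?_, fun b' hb' heq => ?_⟩
  · rw [lkMaxNorm_one_one μ hb.1, lkNorm_one_one]
    refine setLIntegral_congr_fun measurableSet_Ioi fun t ht => ?_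
    simp only [ENNReal.ofReal_toReal (svHat_lt_top hb hint ht).ne]
  · obtain ⟨f, hf, hlt, htop⟩ := hb'.exists_lkNorm_lt_top_lkMaxNorm_eq_top hna hμ
    have hmem : f ∈ {f : X → ℝ | Measurable f ∧ lkMaxNorm μ 1 1 b' f < ∞} :=
      heq ▸ ⟨hf, hlt⟩
    exact hmem.2.ne htop
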